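/- Assume the equation x' = −x² + p(t) has exactly two hyperbolic solutions ã and r̃ (with r̃ < ã). Then for every c > 0, the solutions a_c and r_c of x' = −x² + p(t) − q_c(t) satisfy lim_{t→−∞}|ã(t) − a_c(t)| = 0 and lim_{t→∞}|r̃(t) − r_c(t)| = 0; moreover, a_c is a locally pullback attracting solution and r_c is a locally pullback repulsive solution of x' = −x² + p(t) − q_c(t). -/

import Mathlib

open Set Filter

/-- The right-hand side of the quadratic equation `x' = -x² + Q(t)x + P(t)`. -/
def quadF (Q P : ℝ → ℝ) : ℝ → ℝ → ℝ := fun t x => -x ^ 2 + Q t * x + P t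

/-- `b` is a globally defined bounded solution of `x' = -x² + Q(t)x + P(t)`. -/
def IsBddSol (Q P b : ℝ → ℝ) : Prop :=
  (∀ t, HasDerivAt b (quadF Q P t (b t)) t) ∧ ∃ C, ∀ t, |b t| ≤ C

/-- `(k, β)` is a dichotomy constant pair witnessing that the variational equation
`z' = (-2 b(t) + Q(t)) z` is Hurwitz at `+∞` (attractive case). -/
def AttrDich (Q b : ℝ → ℝ) (k β : ℝ) : Prop :=
  1 ≤ k ∧ 0 < β ∧ ∀ s t : ℝ, s ≤ t →
    Real.exp (∫ l in s..t, (-2 * b l + Q l)) ≤ k * Real.exp (-β * (t - s))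

/-- `(k, β)` is a dichotomy constant pair witnessing that the variational equation
`z' = (-2 b(t) + Q(t)) z` is Hurwitz at `−∞` (repulsive case). -/
def RepDich (Q b : ℝ → ℝ) (k β : ℝ) : Prop :=
  1 ≤ k ∧ 0 < β ∧ ∀ s t : ℝ, t ≤ s →
    Real.exp (∫ l in s..t, (-2 * b l + Q l)) ≤ k * Real.exp (β * (t - s))

/-- `b` is an attractive hyperbolic solution of `x' = -x² + Q(t)x + P(t)`. -/
def IsAttrHyp (Q P b : ℝ → ℝ) : Prop := IsBddSol Q P b ∧ ∃ k β : ℝ, AttrDich Q b k β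

/-- `b` is a repulsive hyperbolic solution of `x' = -x² + Q(t)x + P(t)`. -/
def IsRepHyp (Q P b : ℝ → ℝ) : Prop := IsBddSol Q P b ∧ ∃ k β : ℝ, RepDich Q b k β

/-- `b` is a hyperbolic solution of `x' = -x² + Q(t)x + P(t)`. -/
def IsHyp (Q P b : ℝ → ℝ) : Prop := IsAttrHyp Q P b ∨ IsRepHyp Q P b

/-- The supremum norm distance between `f` and `g` is `< δ`. -/
def SupLt (f g : ℝ → ℝ) (δ : ℝ) : Prop := ∃ d : ℝ, d < δ ∧ ∀ t, |f t - g t| ≤ d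

/-- The family of maximal solutions `t ↦ X t s x₀` of the scalar ODE `x' = h (t, x)`. -/
structure MaxSolFamily (h : ℝ → ℝ → ℝ) where
  X : ℝ → ℝ → ℝ → ℝ
  dom : ℝ → ℝ → Set ℝ
  dom_open : ∀ s x₀, IsOpen (dom s x₀)
  dom_ordConn : ∀ s x₀, (dom s x₀).OrdConnected
  mem_dom : ∀ s x₀, s ∈ dom s x₀
  init : ∀ s x₀, X s s x₀ = x₀
  sol : ∀ s x₀, ∀ t ∈ dom s x₀, HasDerivAt (fun τ => X τ s x₀) (h t (X t s x₀)) t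
  maximal : ∀ s x₀ (y : ℝ → ℝ) (I : Set ℝ), IsOpen I → I.OrdConnected → s ∈ I →
      y s = x₀ → (∀ t ∈ I, HasDerivAt y (h t (y t)) t) →
      I ⊆ dom s x₀ ∧ ∀ t ∈ I, y t = X t s x₀

/-- The solution `X · s x₀` is (defined and) bounded as `t → −∞`. -/
def BddAtBot {h : ℝ → ℝ → ℝ} (F : MaxSolFamily h) (s x₀ : ℝ) : Prop :=
  ∃ C : ℝ, ∀ᶠ t in atBot, t ∈ F.dom s x₀ ∧ |F.X t s x₀| ≤ C

/-- The solution `X · s x₀` is (defined and) bounded as `t → ∞`. -/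
def BddAtTop {h : ℝ → ℝ → ℝ} (F : MaxSolFamily h) (s x₀ : ℝ) : Prop :=
  ∃ C : ℝ, ∀ᶠ t in atTop, t ∈ F.dom s x₀ ∧ |F.X t s x₀| ≤ C

/-- `a` is the globally defined bounded solution characterized by:
`X · s x₀` is bounded as `t → −∞` iff `x₀ ≤ a s`. -/
def CharA {h : ℝ → ℝ → ℝ} (F : MaxSolFamily h) (a : ℝ → ℝ) : Prop :=
  (∀ t, HasDerivAt a (h t (a t)) t) ∧ (∃ C, ∀ t, |a t| ≤ C) ∧
  ∀ s x₀ : ℝ, BddAtBot F s x₀ ↔ x₀ ≤ a s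

/-- `r` is the globally defined bounded solution characterized by:
`X · s x₀` is bounded as `t → ∞` iff `x₀ ≥ r s`. -/
def CharR {h : ℝ → ℝ → ℝ} (F : MaxSolFamily h) (r : ℝ → ℝ) : Prop :=
  (∀ t, HasDerivAt r (h t (r t)) t) ∧ (∃ C, ∀ t, |r t| ≤ C) ∧
  ∀ s x₀ : ℝ, BddAtTop F s x₀ ↔ r s ≤ x₀

def Rminus {h : ℝ → ℝ → ℝ} (F : MaxSolFamily h) : Set ℝ :=
  {s | ∃ x₀, BddAbove ((fun t => F.X t s x₀) '' (F.dom s x₀ ∩ Iic s))}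

def Rplus {h : ℝ → ℝ → ℝ} (F : MaxSolFamily h) : Set ℝ :=
  {s | ∃ x₀, BddBelow ((fun t => F.X t s x₀) '' (F.dom s x₀ ∩ Ici s))}

/-- `q_c(t) = 2c/(π(c²t²+1))`. -/
noncomputable def qc (c : ℝ) : ℝ → ℝ := fun t => 2 * c / (Real.pi * (c ^ 2 * t ^ 2 + 1))

theorem barrier_forward {g g' : ℝ → ℝ} {a b : ℝ}
    (hg : ∀ t ∈ Icc a b, HasDerivAt g (g' t) t) (ha : g a ≤ 0)
    (h0 : ∀ t ∈ Icc a b, g t = 0 → g' t < 0) : ∀ t ∈ Icc a b, g t ≤ 0 := by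
  intro t ht
  exact image_le_of_deriv_right_lt_deriv_boundary (B := fun _ => 0) (B' := fun _ => 0)
    (fun x hx => (hg x hx).continuousAt.continuousWithinAt)
    (fun x hx => (hg x (Ico_subset_Icc_self hx)).hasDerivWithinAt) ha
    (fun x => hasDerivAt_const x 0) (fun x hx => h0 x (Ico_subset_Icc_self hx)) ht

theorem hasDerivAt_comp_neg {g : ℝ → ℝ} {d t : ℝ} (h : HasDerivAt g d (-t)) :
    HasDerivAt (fun x => g (-x)) (-d) t :=
  (HasDerivAt.comp t h (hasDerivAt_neg t)).congr_deriv (by ring)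

theorem barrier_backward {g g' : ℝ → ℝ} {a b : ℝ}
    (hg : ∀ t ∈ Icc a b, HasDerivAt g (g' t) t) (hb : g b ≤ 0)
    (h0 : ∀ t ∈ Icc a b, g t = 0 → 0 < g' t) : ∀ t ∈ Icc a b, g t ≤ 0 := by
  intro t ht
  have hmem : ∀ x ∈ Icc (-b) (-a), -x ∈ Icc a b := fun x hx =>
    ⟨by linarith [hx.2], by linarith [hx.1]⟩
  have := barrier_forward (g := fun x => g (-x)) (g' := fun x => -g' (-x)) (a := -b) (b := -a)
    (fun x hx => hasDerivAt_comp_neg (hg _ (hmem x hx))) (by simpa using hb)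
    (fun x hx h => neg_lt_zero.2 (h0 _ (hmem x hx) h)) (-t)
    ⟨by linarith [ht.2], by linarith [ht.1]⟩
  simpa using this

/-- A bounded positive solution of `w' = 1 - 2 b w`, bounded away from zero. -/
structure IsWeight (b w : ℝ → ℝ) (w₀ w₁ : ℝ) : Prop where
  pos : 0 < w₀
  lower : ∀ t, w₀ ≤ w t
  upper : ∀ t, w t ≤ w₁
  deriv : ∀ t, HasDerivAt w (1 - 2 * b t * w t) t

theorem exists_isWeight {b : ℝ → ℝ} (hb : Continuous b) {M : ℝ} (hM : ∀ t, |b t| ≤ M)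
    {k β : ℝ} (hd : AttrDich (fun _ => 0) b k β) : ∃ w w₀ w₁, IsWeight b w w₀ w₁ := by
  obtain ⟨hk, hβ, hd⟩ := hd
  set f : ℝ → ℝ := fun l => -2 * b l with hf
  have hfc : Continuous f := by fun_prop
  set A : ℝ → ℝ := fun t => ∫ l in (0 : ℝ)..t, f l with hA
  have hAd : ∀ t, HasDerivAt A (f t) t := fun t =>
    intervalIntegral.integral_hasDerivAt_right (hfc.intervalIntegrable _ _)
      (hfc.stronglyMeasurableAtFilter _ _) hfc.continuousAt
  have hAc : Continuous A := continuous_iff_continuousAt.2 fun t => (hAd t).continuousAt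
  have hAsub : ∀ s t, ∫ l in s..t, f l = A t - A s := fun s t =>
    (intervalIntegral.integral_interval_sub_left (hfc.intervalIntegrable _ _)
      (hfc.intervalIntegrable _ _)).symm
  have hdA : ∀ s t, s ≤ t → Real.exp (A t - A s) ≤ k * Real.exp (-β * (t - s)) := by
    intro s t hst
    have := hd s t hst
    simp only [add_zero] at this
    rwa [← hAsub]
  set g : ℝ → ℝ := fun s => Real.exp (-A s) with hg
  have hgc : Continuous g := by fun_prop
  have hgle : ∀ t, ∀ s ∈ Iic t,
      g s ≤ k * Real.exp (-β * t) * Real.exp (-A t) * Real.exp (β * s) := by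
    intro t s hs
    have h1 := mul_le_mul_of_nonneg_right (hdA s t hs) (Real.exp_pos (-A t)).le
    rw [← Real.exp_add] at h1
    have e1 : A t - A s + -A t = -A s := by ring
    have e2 : -β * (t - s) = -β * t + β * s := by ring
    rw [e1, e2, Real.exp_add] at h1
    calc g s ≤ _ := h1
      _ = _ := by ring
  have hdom : ∀ t, MeasureTheory.IntegrableOn
      (fun s => k * Real.exp (-β * t) * Real.exp (-A t) * Real.exp (β * s)) (Iic t) :=
    fun t => (integrableOn_exp_mul_Iic hβ t).const_mul _
  have hgi : ∀ t, MeasureTheory.IntegrableOn g (Iic t) := by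
    intro t
    refine MeasureTheory.Integrable.mono' (hdom t) hgc.aestronglyMeasurable ?_
    filter_upwards [MeasureTheory.ae_restrict_mem measurableSet_Iic] with s hs
    rw [Real.norm_eq_abs, abs_of_pos (Real.exp_pos _)]
    exact hgle t s hs
  set G : ℝ → ℝ := fun t => ∫ s in Iic t, g s with hG
  have hGd : ∀ t, HasDerivAt G (g t) t := by
    intro t
    have h1 : HasDerivAt (fun u => G 0 + ∫ s in (0 : ℝ)..u, g s) (g t) t :=
      (intervalIntegral.integral_hasDerivAt_right (hgc.intervalIntegrable _ _)
        (hgc.stronglyMeasurableAtFilter _ _) hgc.continuousAt).const_add _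
    have h2 : G = fun u => G 0 + ∫ s in (0 : ℝ)..u, g s := by
      funext u
      rw [← intervalIntegral.integral_Iic_sub_Iic (hgi 0) (hgi u)]
      simp [hG]
    rwa [h2]
  have hexp : ∀ t, Real.exp (A t) * Real.exp (-A t) = 1 := fun t => by
    rw [← Real.exp_add]; simp
  refine ⟨fun t => Real.exp (A t) * G t, Real.exp (-(2 * M)), k / β, Real.exp_pos _, ?_, ?_, ?_⟩
  · intro t
    have hle : ∀ s ∈ Ioc (t - 1) t, Real.exp (-A t) * Real.exp (-(2 * M)) ≤ g s := by
      intro s hs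
      rw [← Real.exp_add]
      apply Real.exp_le_exp.2
      have h1 := intervalIntegral.norm_integral_le_of_norm_le_const (a := s) (b := t) (f := f)
        (C := 2 * M) (fun x _ => by
          rw [Real.norm_eq_abs, hf, abs_mul]; norm_num; exact hM x)
      rw [hAsub, Real.norm_eq_abs, abs_of_nonneg (by linarith [hs.2] : 0 ≤ t - s)] at h1
      have hM0 : 0 ≤ M := (abs_nonneg _).trans (hM 0)
      have h2 := (abs_le.1 h1).1
      nlinarith [hs.1]
    have h1 : Real.exp (-A t) * Real.exp (-(2 * M)) ≤ G t := by
      calc Real.exp (-A t) * Real.exp (-(2 * M))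
          = ∫ _ in Ioc (t - 1) t, Real.exp (-A t) * Real.exp (-(2 * M)) := by simp
        _ ≤ ∫ s in Ioc (t - 1) t, g s :=
            MeasureTheory.setIntegral_mono_on continuous_const.integrableOn_Ioc
              ((hgi t).mono_set fun _ hx => hx.2) measurableSet_Ioc hle
        _ ≤ G t := MeasureTheory.setIntegral_mono_set (hgi t)
              (Eventually.of_forall fun s => (Real.exp_pos _).le)
              (show Ioc (t - 1) t ≤ Iic t from fun _ hx => hx.2).eventuallyLE
    calc Real.exp (-(2 * M)) = Real.exp (A t) * Real.exp (-A t) * Real.exp (-(2 * M)) := by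
          rw [hexp, one_mul]
      _ = Real.exp (A t) * (Real.exp (-A t) * Real.exp (-(2 * M))) := by ring
      _ ≤ _ := mul_le_mul_of_nonneg_left h1 (Real.exp_pos _).le
  · intro t
    have h1 : G t ≤ k * Real.exp (-β * t) * Real.exp (-A t) * (Real.exp (β * t) / β) := by
      rw [← integral_exp_mul_Iic hβ t, ← MeasureTheory.integral_const_mul]
      exact MeasureTheory.setIntegral_mono_on (hgi t) (hdom t) measurableSet_Iic (hgle t)
    have h2 : Real.exp (-β * t) * Real.exp (β * t) = 1 := by
      rw [← Real.exp_add]; simp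
    calc Real.exp (A t) * G t
        ≤ Real.exp (A t) * (k * Real.exp (-β * t) * Real.exp (-A t) * (Real.exp (β * t) / β)) :=
          mul_le_mul_of_nonneg_left h1 (Real.exp_pos _).le
      _ = (Real.exp (A t) * Real.exp (-A t)) * (Real.exp (-β * t) * Real.exp (β * t)) * (k / β) := by
          ring
      _ = k / β := by rw [hexp, h2]; ring
  · intro t
    refine ((hAd t).exp.mul (hGd t)).congr_deriv ?_
    have : Real.exp (A t) * g t = 1 := hexp t
    rw [this, hf]
    ring

namespace MaxSolFamily

theorem Icc_subset_dom {h : ℝ → ℝ → ℝ} (F : MaxSolFamily h) {s x₀ t : ℝ}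
    (ht : t ∈ F.dom s x₀) : Icc s t ⊆ F.dom s x₀ :=
  (F.dom_ordConn s x₀).out (F.mem_dom s x₀) ht

/-- A solution that stays bounded on `[s, S]` as long as it exists is defined on `[s, S]`. -/
theorem Icc_subset_dom_of_bdd {P : ℝ → ℝ} (hP : Continuous P)
    (F : MaxSolFamily (quadF (fun _ => 0) P)) {s x₀ S C : ℝ}
    (hC : ∀ t ∈ F.dom s x₀, t ∈ Icc s S → |F.X t s x₀| ≤ C) :
    Icc s S ⊆ F.dom s x₀ := by
  by_contra hcon
  set B : Set ℝ := Icc s S ∩ (F.dom s x₀)ᶜ with hB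
  have hBne : B.Nonempty := by
    obtain ⟨t, ht, ht'⟩ := not_subset.1 hcon
    exact ⟨t, ht, ht'⟩
  have hBbdd : BddBelow B := ⟨s, fun t ht => ht.1.1⟩
  have hBcl : IsClosed B := isClosed_Icc.inter (F.dom_open s x₀).isClosed_compl
  set T := sInf B with hT
  have hTB : T ∈ B := hBcl.csInf_mem hBne hBbdd
  have hsT : s < T := lt_of_le_of_ne hTB.1.1 fun h => hTB.2 (h ▸ F.mem_dom s x₀)
  have hdom : Ico s T ⊆ F.dom s x₀ := by
    intro t ht
    by_contra hn
    exact absurd (csInf_le hBbdd (⟨⟨ht.1, ht.2.le.trans hTB.1.2⟩, hn⟩ : t ∈ B)) (not_le.2 ht.2)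
  set x : ℝ → ℝ := fun t => F.X t s x₀ with hx
  have hxd : ∀ t ∈ F.dom s x₀, HasDerivAt x (-x t ^ 2 + P t) t := fun t ht => by
    simpa [quadF] using F.sol s x₀ t ht
  have hxC : ∀ t ∈ Ico s T, |x t| ≤ C := fun t ht =>
    hC t (hdom ht) ⟨ht.1, ht.2.le.trans hTB.1.2⟩
  obtain ⟨K, hK⟩ := isCompact_Icc.exists_bound_of_continuousOn (hP.continuousOn (s := Icc s T))
  have hlip : LipschitzOnWith (Real.toNNReal (C ^ 2 + K)) x (Ico s T) := by
    refine Convex.lipschitzOnWith_of_nnnorm_hasDerivWithin_le (𝕜 := ℝ) (convex_Ico s T)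
      (fun t ht => (hxd t (hdom ht)).hasDerivWithinAt) (fun t ht => ?_)
    rw [← NNReal.coe_le_coe, coe_nnnorm, Real.norm_eq_abs]
    refine le_trans ?_ (Real.le_coe_toNNReal _)
    have h1 := hxC t ht
    have h2 := hK t (Ico_subset_Icc_self ht)
    rw [Real.norm_eq_abs] at h2
    calc |-x t ^ 2 + P t| ≤ |-x t ^ 2| + |P t| := abs_add_le _ _
      _ ≤ C ^ 2 + K := by
        rw [abs_neg, abs_pow]
        gcongr
  obtain ⟨g, hgl, hgx⟩ := hlip.extend_real
  set L := g T with hL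
  have hlim : Tendsto x (nhdsWithin T (Iio T)) (nhds L) := by
    refine (hgl.continuous.continuousAt.tendsto.mono_left nhdsWithin_le_nhds).congr' ?_
    filter_upwards [Ico_mem_nhdsLT hsT] with t ht using (hgx ht).symm
  set z : ℝ → ℝ := fun t => F.X t T L with hz
  have hzT : z T = L := F.init T L
  have hzd : ∀ t ∈ F.dom T L, HasDerivAt z (-z t ^ 2 + P t) t := fun t ht => by
    simpa [quadF] using F.sol T L t ht
  obtain ⟨ε, hε, hεd⟩ := Metric.isOpen_iff.1 (F.dom_open T L) T (F.mem_dom T L)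
  obtain ⟨δ, hδ, hδd⟩ := Metric.isOpen_iff.1 (F.dom_open s x₀) s (F.mem_dom s x₀)
  set y : ℝ → ℝ := fun t => if t < T then x t else z t with hy
  have hyl : ∀ t, t < T → y t = x t := fun t ht => if_pos ht
  have hyr : ∀ t, T ≤ t → y t = z t := fun t ht => if_neg (not_lt.2 ht)
  have hxdom : ∀ t ∈ Ioo (s - δ) T, t ∈ F.dom s x₀ := by
    intro t ht
    rcases lt_or_ge t s with h | h
    · apply hδd
      rw [Metric.mem_ball, Real.dist_eq, abs_lt]
      constructor <;> linarith [ht.1]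
    · exact hdom ⟨h, ht.2⟩
  have hyleft : ∀ t ∈ Ioo (s - δ) T, HasDerivAt y (-y t ^ 2 + P t) t := by
    intro t ht
    rw [hyl t ht.2]
    exact (hxd t (hxdom t ht)).congr_of_eventuallyEq
      (by filter_upwards [Iio_mem_nhds ht.2] with u hu using hyl u hu)
  have hyT : HasDerivAt y (-y T ^ 2 + P T) T := by
    rw [hyr T le_rfl, hzT]
    have hr : HasDerivWithinAt y (-L ^ 2 + P T) (Ici T) T := by
      have := (hzd T (F.mem_dom T L)).hasDerivWithinAt (s := Ici T)
      rw [hzT] at this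
      exact this.congr (fun t ht => hyr t ht) (hyr T le_rfl)
    have hmem : Ioo (s - δ) T ∈ nhdsWithin T (Iio T) := Ioo_mem_nhdsLT (by linarith)
    have hylim : Tendsto y (nhdsWithin T (Iio T)) (nhds L) := by
      refine hlim.congr' ?_
      filter_upwards [self_mem_nhdsWithin] with t ht using (hyl t ht).symm
    have hl : HasDerivWithinAt y (-L ^ 2 + P T) (Iic T) T := by
      refine hasDerivWithinAt_Iic_of_tendsto_deriv (s := Ioo (s - δ) T)
        (fun t ht => (hyleft t ht).differentiableAt.differentiableWithinAt) ?_ hmem ?_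
      · rw [ContinuousWithinAt, hyr T le_rfl, hzT]
        exact hylim.mono_left (nhdsWithin_mono _ fun t ht => ht.2)
      · refine Tendsto.congr' (f₁ := fun t => -y t ^ 2 + P t) ?_ ?_
        · filter_upwards [hmem] with t ht using (hyleft t ht).deriv.symm
        · exact (hylim.pow 2).neg.add (hP.continuousAt.tendsto.mono_left nhdsWithin_le_nhds)
    have := hl.union hr
    rwa [Iic_union_Ici, hasDerivWithinAt_univ] at this
  have hsub := (F.maximal s x₀ y (Ioo (s - δ) (T + ε)) isOpen_Ioo ordConnected_Ioo
    ⟨by linarith, by linarith⟩ ((hyl s hsT).trans (F.init s x₀)) (fun t ht => by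
      simp only [quadF, zero_mul, add_zero]
      rcases lt_trichotomy t T with h | h | h
      · exact hyleft t ⟨ht.1, h⟩
      · rw [h]; exact hyT
      · rw [hyr t h.le]
        refine (hzd t (hεd ?_)).congr_of_eventuallyEq
          (by filter_upwards [Ioi_mem_nhds h] with u hu using hyr u (le_of_lt hu))
        rw [Metric.mem_ball, Real.dist_eq, abs_lt]
        constructor <;> linarith [ht.2])).1
  exact hTB.2 (hsub ⟨by linarith, by linarith⟩)

/-- The change of variables `(t, x) ↦ (-t, -x)` applied to a family of maximal solutions. -/
def reverse {P : ℝ → ℝ} (F : MaxSolFamily (quadF (fun _ => 0) P)) :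
    MaxSolFamily (quadF (fun _ => 0) (fun t => P (-t))) where
  X t s x₀ := -F.X (-t) (-s) (-x₀)
  dom s x₀ := {t | -t ∈ F.dom (-s) (-x₀)}
  dom_open s x₀ := (F.dom_open (-s) (-x₀)).preimage continuous_neg
  dom_ordConn s x₀ := ⟨fun _ ha _ hb _ ht =>
    (F.dom_ordConn (-s) (-x₀)).out hb ha ⟨neg_le_neg ht.2, neg_le_neg ht.1⟩⟩
  mem_dom s x₀ := F.mem_dom (-s) (-x₀)
  init s x₀ := by rw [F.init, neg_neg]
  sol s x₀ t ht := by
    refine (hasDerivAt_comp_neg (F.sol _ _ _ ht)).neg.congr_deriv ?_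
    simp [quadF]
  maximal s x₀ y I hI hI' hs hys hy := by
    have h := F.maximal (-s) (-x₀) (fun t => -y (-t)) {t | -t ∈ I} (hI.preimage continuous_neg)
      ⟨fun _ ha _ hb _ ht => hI'.out hb ha ⟨neg_le_neg ht.2, neg_le_neg ht.1⟩⟩
      (by simpa using hs) (by simp [hys]) (fun t ht => by
        refine (hasDerivAt_comp_neg (hy _ ht)).neg.congr_deriv ?_
        simp [quadF])
    refine ⟨fun t ht => h.1 (by simpa using ht), fun t ht => ?_⟩
    have := h.2 (-t) (by simpa using ht)
    simp only [neg_neg] at this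
    rw [← this, neg_neg]

theorem Iic_subset_dom_of_bdd {P : ℝ → ℝ} (hP : Continuous P)
    (F : MaxSolFamily (quadF (fun _ => 0) P)) {s x₀ C : ℝ}
    (hC : ∀ t ∈ F.dom s x₀, t ≤ s → |F.X t s x₀| ≤ C) :
    Iic s ⊆ F.dom s x₀ := by
  intro t ht
  have h := F.reverse.Icc_subset_dom_of_bdd (hP.comp continuous_neg) (s := -s) (x₀ := -x₀)
    (S := -t) (C := C) (fun u hu hu' => by
      simp only [reverse, neg_neg, mem_ofPred_eq, abs_neg] at hu ⊢
      exact hC _ hu (by linarith [hu'.1]))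
  simpa [reverse] using h ⟨neg_le_neg ht, le_rfl⟩

end MaxSolFamily

section Perturbation

variable {p q b w : ℝ → ℝ} {w₀ w₁ M : ℝ}

theorem IsWeight.pos_at (hw : IsWeight b w w₀ w₁) (t : ℝ) : 0 < w t := hw.pos.trans_le (hw.lower t)

theorem IsWeight.pos_upper (hw : IsWeight b w w₀ w₁) : 0 < w₁ := (hw.pos_at 0).trans_le (hw.upper 0)

theorem IsWeight.mul_sq_le (hw : IsWeight b w w₀ w₁) {ρ : ℝ} (hρ : 0 < ρ)
    (hρw : 4 * ρ * w₁ ^ 2 ≤ 1) (t : ℝ) : 4 * ρ * w t ^ 2 ≤ 1 := by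
  have h : w t ^ 2 ≤ w₁ ^ 2 := pow_le_pow_left₀ (hw.pos_at t).le (hw.upper t) 2
  nlinarith

/-- Under a small perturbation, solutions starting near an attractive hyperbolic solution `b`
are defined and stay near `b` in the future. -/
theorem MaxSolFamily.trapped (hp : Continuous p) (hq : Continuous q)
    (F : MaxSolFamily (quadF (fun _ => 0) (fun t => p t - q t)))
    (hb : ∀ t, HasDerivAt b (quadF (fun _ => 0) p t (b t)) t) (hM : ∀ t, |b t| ≤ M)
    (hw : IsWeight b w w₀ w₁) {s S x₀ ρ : ℝ} (hρ : 0 < ρ) (hρw : 4 * ρ * w₁ ^ 2 ≤ 1)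
    (hqρ : ∀ t ∈ Icc s S, |q t| ≤ ρ / 2) (hx : |x₀ - b s| ≤ ρ * w s) :
    Icc s S ⊆ F.dom s x₀ ∧ ∀ t ∈ Icc s S, |F.X t s x₀ - b t| ≤ ρ * w t := by
  have key : ∀ t ∈ F.dom s x₀, t ∈ Icc s S → |F.X t s x₀ - b t| ≤ ρ * w t := by
    intro t ht htS
    have hX : ∀ u ∈ Icc s t, HasDerivAt (fun τ => F.X τ s x₀)
        (quadF (fun _ => 0) (fun t => p t - q t) u (F.X u s x₀)) u :=
      fun u hu => F.sol s x₀ u (F.Icc_subset_dom ht hu)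
    have hini := abs_le.1 hx
    have hup := barrier_forward (g := fun u => F.X u s x₀ - b u - ρ * w u)
      (fun u hu => ((hX u hu).sub (hb u)).sub ((hw.deriv u).const_mul ρ))
      (by simp only [F.init]; linarith [hini.2])
      (fun u hu h => by
        have e : F.X u s x₀ = b u + ρ * w u := by linarith
        have h1 := abs_le.1 (hqρ u ⟨hu.1, hu.2.trans htS.2⟩)
        simp only [quadF, e]
        nlinarith [sq_nonneg (ρ * w u), h1.1])
    have hlo := barrier_forward (g := fun u => b u - ρ * w u - F.X u s x₀)
      (fun u hu => ((hb u).sub ((hw.deriv u).const_mul ρ)).sub (hX u hu))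
      (by simp only [F.init]; linarith [hini.1])
      (fun u hu h => by
        have e : F.X u s x₀ = b u - ρ * w u := by linarith
        have h1 := abs_le.1 (hqρ u ⟨hu.1, hu.2.trans htS.2⟩)
        have h2 := mul_le_mul_of_nonneg_left (hw.mul_sq_le hρ hρw u) hρ.le
        simp only [quadF, e]
        nlinarith [h1.2])
    have h1 := hup t ⟨htS.1, le_rfl⟩
    have h2 := hlo t ⟨htS.1, le_rfl⟩
    rw [abs_le]
    constructor <;> linarith
  have hsub := F.Icc_subset_dom_of_bdd (hp.sub hq) (s := s) (x₀ := x₀) (S := S)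
    (C := M + ρ * w₁) (fun t ht htS => by
      have h1 := abs_le.1 (key t ht htS)
      have h2 := abs_le.1 (hM t)
      have h3 := mul_le_mul_of_nonneg_left (hw.upper t) hρ.le
      rw [abs_le]
      constructor <;> linarith [h1.1, h1.2, h2.1, h2.2])
  exact ⟨hsub, fun t ht => key t (hsub ht) ht⟩

/-- A solution bounded in the past cannot exceed an attractive hyperbolic solution by much. -/
theorem le_of_bdd_past (hb : ∀ t, HasDerivAt b (quadF (fun _ => 0) p t (b t)) t)
    (hM : ∀ t, |b t| ≤ M) (hw : IsWeight b w w₀ w₁) {y : ℝ → ℝ} {T η C : ℝ} (hη : 0 < η)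
    (hy : ∀ t ≤ T, HasDerivAt y (quadF (fun _ => 0) (fun t => p t - q t) t (y t)) t)
    (hC : ∀ᶠ t in atBot, |y t| ≤ C) (hq : ∀ t ≤ T, |q t| ≤ η / 4) :
    ∀ t ≤ T, y t ≤ b t + η * w t := by
  intro t₁ ht₁
  by_contra! hcon
  have hw₁ := hw.pos_upper
  set l := η / (4 * w₁) with hl
  have hl0 : 0 < l := by positivity
  have hlw : l * w₁ = η / 4 := by rw [hl]; field_simp
  have hgrow : ∀ t ≤ t₁, b t + (η + l * (t₁ - t)) * w t ≤ y t := by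
    intro t ht
    have hd : ∀ u, HasDerivAt (fun u => η + l * (t₁ - u)) (-l) u := fun u =>
      ((((hasDerivAt_id u).const_sub t₁).const_mul l).const_add η).congr_deriv (by ring)
    have := barrier_backward (g := fun u => b u + (η + l * (t₁ - u)) * w u - y u) (a := t) (b := t₁)
      (fun u hu => ((hb u).add ((hd u).mul (hw.deriv u))).sub (hy u (hu.2.trans ht₁)))
      (by simp only [sub_self, mul_zero, add_zero]; linarith)
      (fun u hu h => by
        have e : y u = b u + (η + l * (t₁ - u)) * w u := by linarith
        have h1 := abs_le.1 (hq u (hu.2.trans ht₁))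
        have h2 := mul_le_mul_of_nonneg_left (hw.upper u) hl0.le
        have h3 : 0 ≤ l * (t₁ - u) := mul_nonneg hl0.le (by linarith [hu.2])
        simp only [quadF, e]
        generalize l * (t₁ - u) = m at *
        nlinarith [sq_nonneg ((η + m) * w u), h1.1])
      t ⟨le_rfl, ht⟩
    linarith
  obtain ⟨t, ht1, ht2, ht3⟩ := (hC.and ((eventually_le_atBot t₁).and
    (eventually_le_atBot (t₁ - (C + M + 1) / (l * w₀))))).exists
  have h0 := hw.pos
  have h1 := hgrow t ht2
  have h2 : C + M + 1 ≤ l * w₀ * (t₁ - t) := by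
    have : (C + M + 1) / (l * w₀) ≤ t₁ - t := by linarith
    rwa [div_le_iff₀' (by positivity)] at this
  have h3 : l * w₀ * (t₁ - t) ≤ (η + l * (t₁ - t)) * w t := by
    have h4 : 0 ≤ l * (t₁ - t) := mul_nonneg hl0.le (by linarith)
    nlinarith [hw.lower t, hw.pos_at t]
  linarith [(abs_le.1 ht1).2, (abs_le.1 (hM t)).1]

/-- Solutions starting slightly below an attractive hyperbolic solution are bounded in the
past. -/
theorem MaxSolFamily.bddAtBot_below (hp : Continuous p) (hq : Continuous q)
    (F : MaxSolFamily (quadF (fun _ => 0) (fun t => p t - q t)))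
    (hb : ∀ t, HasDerivAt b (quadF (fun _ => 0) p t (b t)) t) (hM : ∀ t, |b t| ≤ M)
    (hw : IsWeight b w w₀ w₁) {T η C : ℝ} (hη : 0 < η) (hηw : 4 * η * w₁ ^ 2 ≤ 1)
    (hpC : ∀ t, |p t| ≤ C) (hqη : ∀ t ≤ T, |q t| ≤ η / 2) :
    BddAtBot F T (b T - η * w T) := by
  set x₀ := b T - η * w T with hx₀
  set R := M + η * w₁ + C + η + 1 with hR
  have hM0 : 0 ≤ M := (abs_nonneg _).trans (hM 0)
  have hC0 : 0 ≤ C := (abs_nonneg _).trans (hpC 0)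
  have hw₁ := hw.pos_upper
  have hηw₁ : 0 < η * w₁ := mul_pos hη hw₁
  have key : ∀ t ∈ F.dom T x₀, t ≤ T → |F.X t T x₀| ≤ R := by
    intro t ht htT
    have hX : ∀ u ∈ Icc t T, HasDerivAt (fun τ => F.X τ T x₀)
        (quadF (fun _ => 0) (fun t => p t - q t) u (F.X u T x₀)) u :=
      fun u hu => F.sol T x₀ u ((F.dom_ordConn T x₀).out ht (F.mem_dom T x₀) hu)
    have hup := barrier_backward (g := fun u => F.X u T x₀ - (b u - η * w u))
      (fun u hu => (hX u hu).sub ((hb u).sub ((hw.deriv u).const_mul η)))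
      (by simp only [F.init]; linarith)
      (fun u hu h => by
        have e : F.X u T x₀ = b u - η * w u := by linarith
        have h1 := abs_le.1 (hqη u hu.2)
        have h2 := mul_le_mul_of_nonneg_left (hw.mul_sq_le hη hηw u) hη.le
        simp only [quadF, e]
        nlinarith [h1.2]) t ⟨le_rfl, htT⟩
    have hlo := barrier_backward (g := fun u => -R - F.X u T x₀)
      (fun u hu => (hX u hu).const_sub (-R))
      (by
        have h1 := mul_le_mul_of_nonneg_left (hw.upper T) hη.le
        simp only [F.init]
        linarith [(abs_le.1 (hM T)).1])
      (fun u hu h => by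
        have e : F.X u T x₀ = -R := by linarith
        have h1 := abs_le.1 (hqη u hu.2)
        have h2 := abs_le.1 (hpC u)
        have h3 : R ≤ R ^ 2 := by nlinarith
        simp only [quadF, e]
        nlinarith [h1.1, h2.2]) t ⟨le_rfl, htT⟩
    have h1 := mul_pos hη (hw.pos_at t)
    rw [abs_le]
    constructor <;> linarith [(abs_le.1 (hM t)).2]
  have hsub := F.Iic_subset_dom_of_bdd (hp.sub hq) key
  refine ⟨R, ?_⟩
  filter_upwards [eventually_le_atBot T] with t ht using ⟨hsub ht, key t (hsub ht) ht⟩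

/-- Solutions that stay near an attractive hyperbolic solution approach each other
exponentially. -/
theorem sq_sub_le_exp (hw : IsWeight b w w₀ w₁) {P y z : ℝ → ℝ} {s S ρ : ℝ} (hsS : s ≤ S)
    (hρ : 0 < ρ) (hρw : 4 * ρ * w₁ ^ 2 ≤ 1)
    (hy : ∀ t ∈ Icc s S, HasDerivAt y (quadF (fun _ => 0) P t (y t)) t)
    (hz : ∀ t ∈ Icc s S, HasDerivAt z (quadF (fun _ => 0) P t (z t)) t)
    (hyb : ∀ t ∈ Icc s S, |y t - b t| ≤ ρ * w t)
    (hzb : ∀ t ∈ Icc s S, |z t - b t| ≤ ρ * w t) :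
    (y S - z S) ^ 2 ≤ (w₁ / w₀ * (y s - z s)) ^ 2 * Real.exp (-(S - s) / w₁) := by
  have hw₁ := hw.pos_upper
  have hw₀ := hw.pos
  have hd : ∀ t ∈ Icc s S, HasDerivAt (fun t => ((y t - z t) / w t) ^ 2 * Real.exp (t / w₁))
      (((y t - z t) / w t) ^ 2 * Real.exp (t / w₁) *
        (-2 * ((y t - b t) + (z t - b t)) - 2 / w t + 1 / w₁)) t := by
    intro t ht
    have hne := (hw.pos_at t).ne'
    refine (((((hy t ht).sub (hz t ht)).div (hw.deriv t) hne).pow 2).mul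
      ((hasDerivAt_id t).div_const w₁).exp).congr_deriv ?_
    simp only [quadF, Pi.sub_apply, Pi.div_apply, id, Pi.pow_apply, Nat.cast_ofNat, Nat.add_one_sub_one, pow_one]
    field_simp
    ring
  have hanti : AntitoneOn (fun t => ((y t - z t) / w t) ^ 2 * Real.exp (t / w₁)) (Icc s S) := by
    refine antitoneOn_of_deriv_nonpos (convex_Icc s S)
      (fun t ht => (hd t ht).continuousAt.continuousWithinAt)
      (fun t ht => (hd t (interior_subset ht)).differentiableAt.differentiableWithinAt)
      (fun t ht => ?_)
    have ht' := interior_subset ht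
    rw [(hd t ht').deriv]
    refine mul_nonpos_of_nonneg_of_nonpos (by positivity) ?_
    have h1 := (abs_le.1 (hyb t ht')).1
    have h2 := (abs_le.1 (hzb t ht')).1
    have h3 : 1 / w₁ ≤ 1 / w t := one_div_le_one_div_of_le (hw.pos_at t) (hw.upper t)
    have h4 : 4 * (ρ * w t) ≤ 1 / w₁ := by
      rw [le_div_iff₀ hw₁]
      nlinarith [mul_le_mul_of_nonneg_left (hw.upper t) (mul_pos hρ hw₁).le]
    have h5 : 2 / w t = 2 * (1 / w t) := by ring
    linarith
  have h := hanti ⟨le_rfl, hsS⟩ ⟨hsS, le_rfl⟩ hsS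
  simp only at h
  have h1 : (y S - z S) ^ 2 ≤ w₁ ^ 2 * ((y S - z S) / w S) ^ 2 := by
    rw [div_pow, mul_div_assoc', le_div_iff₀ (pow_pos (hw.pos_at S) 2), mul_comm]
    exact mul_le_mul_of_nonneg_right (pow_le_pow_left₀ (hw.pos_at S).le (hw.upper S) 2)
      (sq_nonneg _)
  have h2 : ((y s - z s) / w s) ^ 2 ≤ ((y s - z s) / w₀) ^ 2 := by
    rw [div_pow, div_pow]
    exact div_le_div_of_nonneg_left (sq_nonneg _) (by positivity)
      (pow_le_pow_left₀ hw₀.le (hw.lower s) 2)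
  have h3 : ((y S - z S) / w S) ^ 2 ≤ ((y s - z s) / w s) ^ 2 * Real.exp (-(S - s) / w₁) := by
    have h4 : Real.exp (-(S - s) / w₁) = Real.exp (s / w₁) / Real.exp (S / w₁) := by
      rw [← Real.exp_sub]; congr 1; ring
    rw [h4, mul_div_assoc', le_div_iff₀ (Real.exp_pos _)]
    exact h
  calc (y S - z S) ^ 2 ≤ w₁ ^ 2 * ((y S - z S) / w S) ^ 2 := h1
    _ ≤ w₁ ^ 2 * (((y s - z s) / w₀) ^ 2 * Real.exp (-(S - s) / w₁)) := by
      gcongr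
      exact h3.trans (mul_le_mul_of_nonneg_right h2 (Real.exp_pos _).le)
    _ = _ := by ring

end Perturbation

theorem exists_isWeight_of_isAttrHyp {p b : ℝ → ℝ} (h : IsAttrHyp (fun _ => 0) p b) :
    ∃ w w₀ w₁ M, IsWeight b w w₀ w₁ ∧ ∀ t, |b t| ≤ M := by
  obtain ⟨⟨hb, M, hM⟩, k, β, hd⟩ := h
  obtain ⟨w, w₀, w₁, hw⟩ :=
    exists_isWeight (continuous_iff_continuousAt.2 fun t => (hb t).continuousAt) hM hd
  exact ⟨w, w₀, w₁, M, hw, hM⟩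

theorem IsBddSol.reverse {p b : ℝ → ℝ} (h : IsBddSol (fun _ => 0) p b) :
    IsBddSol (fun _ => 0) (fun t => p (-t)) (fun t => -b (-t)) := by
  obtain ⟨hb, M, hM⟩ := h
  refine ⟨fun t => (hasDerivAt_comp_neg (hb (-t))).neg.congr_deriv ?_, M, fun t => ?_⟩
  · simp [quadF]
  · rw [abs_neg]; exact hM _

theorem integral_reverse (b : ℝ → ℝ) (s t : ℝ) :
    ∫ l in s..t, (-2 * -b (-l) + 0) = ∫ l in (-s)..(-t), (-2 * b l + 0) := by
  have h := intervalIntegral.integral_comp_neg (a := s) (b := t) (fun l => -2 * -b l + 0)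
  rw [h, intervalIntegral.integral_symm, ← intervalIntegral.integral_neg]
  congr 1
  funext l
  ring

theorem IsRepHyp.reverse {p b : ℝ → ℝ} (h : IsRepHyp (fun _ => 0) p b) :
    IsAttrHyp (fun _ => 0) (fun t => p (-t)) (fun t => -b (-t)) := by
  obtain ⟨hb, k, β, hk, hβ, hd⟩ := h
  refine ⟨hb.reverse, k, β, hk, hβ, fun s t hst => ?_⟩
  rw [integral_reverse]
  refine (hd (-s) (-t) (neg_le_neg hst)).trans_eq ?_
  ring_nf

theorem IsAttrHyp.reverse {p b : ℝ → ℝ} (h : IsAttrHyp (fun _ => 0) p b) :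
    IsRepHyp (fun _ => 0) (fun t => p (-t)) (fun t => -b (-t)) := by
  obtain ⟨hb, k, β, hk, hβ, hd⟩ := h
  refine ⟨hb.reverse, k, β, hk, hβ, fun s t hst => ?_⟩
  rw [integral_reverse]
  refine (hd (-s) (-t) (neg_le_neg hst)).trans_eq ?_
  ring_nf

theorem exists_abs_le_of_tendsto_zero {q : ℝ → ℝ} (hq : Tendsto q atBot (nhds 0)) {ε : ℝ}
    (hε : 0 < ε) : ∃ T, ∀ t ≤ T, |q t| ≤ ε := by
  have h := hq.eventually (Metric.closedBall_mem_nhds (0 : ℝ) hε)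
  obtain ⟨T, hT⟩ := eventually_atBot.1 h
  exact ⟨T, fun t ht => by simpa [Real.dist_eq] using hT t ht⟩

/-- If the unperturbed equation has a repulsive hyperbolic solution and the perturbation vanishes
at `-∞`, then `Rminus` contains a negative half-line. -/
theorem exists_Iic_subset_Rminus {p q r : ℝ → ℝ} (hp : Continuous p) (hq : Continuous q)
    (hq0 : Tendsto q atBot (nhds 0)) (hr : IsRepHyp (fun _ => 0) p r)
    (F : MaxSolFamily (quadF (fun _ => 0) (fun t => p t - q t))) :
    ∃ T, Iic T ⊆ Rminus F := by
  have hr' := hr.reverse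
  obtain ⟨w, w₀, w₁, M, hw, hM⟩ := exists_isWeight_of_isAttrHyp hr'
  have hw₁ := hw.pos_upper
  have hρ : 0 < 1 / (4 * w₁ ^ 2) := by positivity
  have hρw : 4 * (1 / (4 * w₁ ^ 2)) * w₁ ^ 2 ≤ 1 := le_of_eq (by field_simp)
  set ρ := 1 / (4 * w₁ ^ 2)
  obtain ⟨T, hT⟩ := exists_abs_le_of_tendsto_zero hq0 (half_pos hρ)
  refine ⟨T, fun s hs => ⟨r s, M + ρ * w₁, ?_⟩⟩
  rintro _ ⟨t, ⟨-, hts⟩, rfl⟩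
  have h := (MaxSolFamily.trapped (hp.comp continuous_neg) (hq.comp continuous_neg)
    (MaxSolFamily.reverse F) hr'.1.1 hM hw (s := -s) (S := -t) (x₀ := -r s) hρ hρw
    (fun u hu => hT _ (by linarith [hu.1, mem_Iic.1 hs]))
    (by
      rw [neg_neg, sub_self, abs_zero]
      exact (mul_pos hρ (hw.pos_at _)).le)).2 (-t) ⟨neg_le_neg hts, le_rfl⟩
  simp only [MaxSolFamily.reverse, neg_neg] at h
  have h1 := (abs_le.1 h).1
  have h2 := (abs_le.1 (hM (-t))).1
  rw [neg_neg] at h2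
  have h3 := mul_le_mul_of_nonneg_left (hw.upper (-t)) hρ.le
  simp only
  linarith

theorem asymptotics_past {p q b r a : ℝ → ℝ} (hp : Continuous p) (hpb : ∃ C, ∀ t, |p t| ≤ C)
    (hq : Continuous q) (hq0 : Tendsto q atBot (nhds 0))
    (hb : IsAttrHyp (fun _ => 0) p b) (hr : IsRepHyp (fun _ => 0) p r)
    (F : MaxSolFamily (quadF (fun _ => 0) (fun t => p t - q t)))
    (ha : ∀ t ∈ Rminus F, HasDerivAt a (quadF (fun _ => 0) (fun τ => p τ - q τ) t (a t)) t)
    (hchar : ∀ s ∈ Rminus F, ∀ x₀ : ℝ, BddAtBot F s x₀ ↔ x₀ ≤ a s) :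
    Tendsto (fun t => b t - a t) atBot (nhds 0) ∧
    ∃ s₀ ∈ Rminus F, ∃ δ > (0 : ℝ),
      (∀ s, s ≤ s₀ → Icc s s₀ ⊆ F.dom s (a s + δ) ∧ Icc s s₀ ⊆ F.dom s (a s - δ)) ∧
      (∀ t, t ≤ s₀ →
        Tendsto (fun s => F.X t s (a s + δ)) atBot (nhds (a t)) ∧
        Tendsto (fun s => F.X t s (a s - δ)) atBot (nhds (a t))) := by
  obtain ⟨Cp, hCp⟩ := hpb
  obtain ⟨T₁, hT₁⟩ := exists_Iic_subset_Rminus hp hq hq0 hr F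
  obtain ⟨w, w₀, w₁, M, hw, hM⟩ := exists_isWeight_of_isAttrHyp hb
  have hbs := hb.1.1
  have hw₁ := hw.pos_upper
  have hw₀ := hw.pos
  have habdd : ∃ C, ∀ᶠ t in atBot, |a t| ≤ C := by
    have hmem : T₁ - 1 ∈ Rminus F := hT₁ (by simp)
    obtain ⟨C, hC⟩ := (hchar _ hmem (a (T₁ - 1))).2 le_rfl
    refine ⟨C, ?_⟩
    have hX := (F.maximal (T₁ - 1) (a (T₁ - 1)) a (Iio T₁) isOpen_Iio ordConnected_Iio
      (by simp) rfl (fun t ht => ha t (hT₁ (mem_Iic.2 (le_of_lt ht))))).2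
    filter_upwards [hC, eventually_lt_atBot T₁] with t ht ht'
    rw [hX t ht']
    exact ht.2
  obtain ⟨Ca, hCa⟩ := habdd
  have hclose : ∀ η, 0 < η → 4 * η * w₁ ^ 2 ≤ 1 →
      ∃ T ≤ T₁, (∀ t ≤ T, |q t| ≤ η / 4) ∧ ∀ t ≤ T, |a t - b t| ≤ η * w t := by
    intro η hη hηw
    obtain ⟨T₂, hT₂⟩ := exists_abs_le_of_tendsto_zero hq0 (ε := η / 4) (by positivity)
    have hq' : ∀ t ≤ min T₁ T₂, |q t| ≤ η / 4 := fun t ht => hT₂ t (ht.trans (min_le_right _ _))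
    refine ⟨min T₁ T₂, min_le_left _ _, hq', fun t ht => ?_⟩
    have hup := le_of_bdd_past hbs hM hw hη
      (fun u hu => ha u (hT₁ (hu.trans (min_le_left _ _)))) hCa hq' t ht
    have hlo := (hchar t (hT₁ (ht.trans (min_le_left _ _))) _).1
      (F.bddAtBot_below hp hq hbs hM hw hη hηw hCp (T := t)
        (fun u hu => (hq' u (hu.trans ht)).trans (by linarith)))
    rw [abs_le]
    constructor <;> linarith
  set ρ := 1 / (4 * w₁ ^ 2) with hρdef
  have hρ : 0 < ρ := by positivity
  have hρw : 4 * ρ * w₁ ^ 2 = 1 := by rw [hρdef]; field_simp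
  constructor
  · rw [Metric.tendsto_nhds]
    intro ε hε
    set η := min ρ (ε / (2 * w₁)) with hη
    have hη0 : 0 < η := lt_min hρ (by positivity)
    have hηw : 4 * η * w₁ ^ 2 ≤ 1 := by
      rw [← hρw]
      have := min_le_left ρ (ε / (2 * w₁))
      gcongr
    obtain ⟨T, -, -, hT⟩ := hclose η hη0 hηw
    filter_upwards [eventually_le_atBot T] with t ht
    rw [Real.dist_eq, sub_zero, abs_sub_comm]
    have h1 : η * w₁ ≤ ε / 2 := by
      have := mul_le_mul_of_nonneg_right (min_le_right ρ (ε / (2 * w₁))) hw₁.le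
      have e : ε / (2 * w₁) * w₁ = ε / 2 := by field_simp
      linarith
    have h2 := mul_le_mul_of_nonneg_left (hw.upper t) hη0.le
    linarith [hT t ht]
  · obtain ⟨T, hTT₁, hqT, hT⟩ := hclose (ρ / 2) (half_pos hρ) (by nlinarith [sq_nonneg w₁])
    have hmain : ∀ d, |d| ≤ ρ / 2 * w₀ →
        (∀ s, s ≤ T → Icc s T ⊆ F.dom s (a s + d)) ∧
        ∀ t, t ≤ T → Tendsto (fun s => F.X t s (a s + d)) atBot (nhds (a t)) := by
      intro d hd
      have htrap : ∀ s ≤ T, Icc s T ⊆ F.dom s (a s + d) ∧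
          ∀ t ∈ Icc s T, |F.X t s (a s + d) - b t| ≤ ρ * w t := fun s hs =>
        F.trapped hp hq hbs hM hw hρ hρw.le
          (fun t ht => (hqT t ht.2).trans (by linarith))
          (by
            have h1 := mul_le_mul_of_nonneg_left (hw.lower s) (half_pos hρ).le
            have e : a s + d - b s = (a s - b s) + d := by ring
            rw [e]
            linarith [abs_add_le (a s - b s) d, hT s hs])
      refine ⟨fun s hs => (htrap s hs).1, fun t ht => ?_⟩
      have hbound : ∀ᶠ s in atBot, (F.X t s (a s + d) - a t) ^ 2 ≤
          (w₁ / w₀ * d) ^ 2 * Real.exp (-(t - s) / w₁) := by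
        filter_upwards [eventually_le_atBot t] with s hs
        have h := sq_sub_le_exp hw (P := fun τ => p τ - q τ)
          (y := fun τ => F.X τ s (a s + d)) (z := a) hs hρ hρw.le
          (fun u hu => F.sol _ _ u ((htrap s (hs.trans ht)).1 ⟨hu.1, hu.2.trans ht⟩))
          (fun u hu => ha u (hT₁ ((hu.2.trans ht).trans hTT₁)))
          (fun u hu => (htrap s (hs.trans ht)).2 u ⟨hu.1, hu.2.trans ht⟩)
          (fun u hu => by
            have := mul_pos hρ (hw.pos_at u)
            linarith [hT u (hu.2.trans ht)])
        simpa only [F.init, add_sub_cancel_left] using h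
      have hlim : Tendsto (fun s => (w₁ / w₀ * d) ^ 2 * Real.exp (-(t - s) / w₁)) atBot
          (nhds 0) := by
        have h1 : Tendsto (fun s : ℝ => -(t - s) / w₁) atBot atBot := by
          refine Tendsto.atBot_div_const hw₁ ?_
          simp only [neg_sub]
          exact tendsto_atBot_add_const_right _ (-t) tendsto_id
        simpa using (Real.tendsto_exp_atBot.comp h1).const_mul ((w₁ / w₀ * d) ^ 2)
      have hsq : Tendsto (fun s => (F.X t s (a s + d) - a t) ^ 2) atBot (nhds 0) :=
        tendsto_of_tendsto_of_tendsto_of_le_of_le' tendsto_const_nhds hlim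
          (Eventually.of_forall fun s => sq_nonneg _) hbound
      have habs : Tendsto (fun s => |F.X t s (a s + d) - a t|) atBot (nhds 0) := by
        have := (Real.continuous_sqrt.tendsto 0).comp hsq
        simpa [Function.comp_def, Real.sqrt_sq_eq_abs] using this
      exact tendsto_sub_nhds_zero_iff.1 (tendsto_zero_iff_abs_tendsto_zero _ |>.2 habs)
    have hδ : 0 < ρ / 2 * w₀ := by positivity
    have hpos := hmain (ρ / 2 * w₀) (abs_of_pos hδ).le
    have hneg := hmain (-(ρ / 2 * w₀)) (by rw [abs_neg]; exact (abs_of_pos hδ).le)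
    simp only [← sub_eq_add_neg] at hneg
    exact ⟨T, hT₁ hTT₁, ρ / 2 * w₀, hδ, fun s hs => ⟨hpos.1 s hs, hneg.1 s hs⟩,
      fun t ht => ⟨hpos.2 t ht, hneg.2 t ht⟩⟩

section Reverse

variable {P : ℝ → ℝ} (F : MaxSolFamily (quadF (fun _ => 0) P))

theorem mem_Rminus_reverse {s : ℝ} : s ∈ Rminus F.reverse ↔ -s ∈ Rplus F := by
  constructor
  · rintro ⟨x₀, C, hC⟩
    refine ⟨-x₀, -C, ?_⟩
    rintro _ ⟨t, ⟨ht, hts⟩, rfl⟩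
    have := hC ⟨-t, ⟨by simpa [MaxSolFamily.reverse] using ht, mem_Iic.2 (neg_le.1 (mem_Ici.1 hts))⟩, rfl⟩
    simp only [MaxSolFamily.reverse, neg_neg] at this
    simp only
    linarith
  · rintro ⟨x₀, C, hC⟩
    refine ⟨-x₀, -C, ?_⟩
    rintro _ ⟨t, ⟨ht, hts⟩, rfl⟩
    have := hC ⟨-t, ⟨by simpa [MaxSolFamily.reverse] using ht, mem_Ici.2 (neg_le_neg (mem_Iic.1 hts))⟩, rfl⟩
    simp only [MaxSolFamily.reverse, neg_neg] at this ⊢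
    linarith

theorem bddAtBot_reverse {s x₀ : ℝ} : BddAtBot F.reverse s x₀ ↔ BddAtTop F (-s) (-x₀) := by
  constructor
  · rintro ⟨C, hC⟩
    refine ⟨C, (tendsto_neg_atTop_atBot.eventually hC).mono fun t ht => ?_⟩
    simpa [MaxSolFamily.reverse] using ht
  · rintro ⟨C, hC⟩
    refine ⟨C, (tendsto_neg_atBot_atTop.eventually hC).mono fun t ht => ?_⟩
    simpa [MaxSolFamily.reverse] using ht

end Reverse

theorem asymptotics_future {p q b r a : ℝ → ℝ} (hp : Continuous p) (hpb : ∃ C, ∀ t, |p t| ≤ C)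
    (hq : Continuous q) (hq0 : Tendsto q atTop (nhds 0))
    (hb : IsAttrHyp (fun _ => 0) p b) (hr : IsRepHyp (fun _ => 0) p r)
    (F : MaxSolFamily (quadF (fun _ => 0) (fun t => p t - q t)))
    (ha : ∀ t ∈ Rplus F, HasDerivAt a (quadF (fun _ => 0) (fun τ => p τ - q τ) t (a t)) t)
    (hchar : ∀ s ∈ Rplus F, ∀ x₀ : ℝ, BddAtTop F s x₀ ↔ a s ≤ x₀) :
    Tendsto (fun t => r t - a t) atTop (nhds 0) ∧
    ∃ s₀ ∈ Rplus F, ∃ δ > (0 : ℝ),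
      (∀ s, s₀ ≤ s → Icc s₀ s ⊆ F.dom s (a s + δ) ∧ Icc s₀ s ⊆ F.dom s (a s - δ)) ∧
      (∀ t, s₀ ≤ t →
        Tendsto (fun s => F.X t s (a s + δ)) atTop (nhds (a t)) ∧
        Tendsto (fun s => F.X t s (a s - δ)) atTop (nhds (a t))) := by
  obtain ⟨C, hC⟩ := hpb
  obtain ⟨hlim, s₀, hs₀, δ, hδ, hdom, hpull⟩ :=
    asymptotics_past (p := fun t => p (-t)) (q := fun t => q (-t)) (a := fun t => -a (-t))
      (hp.comp continuous_neg) ⟨C, fun t => hC _⟩ (hq.comp continuous_neg)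
      (hq0.comp tendsto_neg_atBot_atTop) hr.reverse hb.reverse (MaxSolFamily.reverse F)
      (fun t ht => by
        refine (hasDerivAt_comp_neg (ha (-t) ((mem_Rminus_reverse F).1 ht))).neg.congr_deriv ?_
        simp [quadF])
      (fun s hs x₀ => (bddAtBot_reverse F).trans
        ((hchar (-s) ((mem_Rminus_reverse F).1 hs) (-x₀)).trans le_neg))
  refine ⟨?_, -s₀, (mem_Rminus_reverse F).1 hs₀, δ, hδ, fun s hs => ?_, fun t ht => ?_⟩
  · have := (hlim.comp tendsto_neg_atTop_atBot).neg
    simp only [neg_zero] at this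
    refine this.congr fun t => ?_
    simp only [Function.comp, neg_neg]
    ring
  · have h := hdom (-s) (neg_le.1 hs)
    have hIcc : ∀ t ∈ Icc (-s₀) s, -t ∈ Icc (-s) s₀ := fun t ht =>
      ⟨neg_le_neg ht.2, neg_le.1 ht.1⟩
    constructor
    · intro t ht
      simpa [MaxSolFamily.reverse, add_comm] using h.2 (hIcc t ht)
    · intro t ht
      simpa [MaxSolFamily.reverse, ← sub_eq_neg_add] using h.1 (hIcc t ht)
  · have h := hpull (-t) (neg_le.1 ht)
    constructor
    · have := (h.2.comp tendsto_neg_atTop_atBot).neg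
      simpa [MaxSolFamily.reverse, Function.comp_def, add_comm] using this
    · have := (h.1.comp tendsto_neg_atTop_atBot).neg
      simpa [MaxSolFamily.reverse, Function.comp_def, ← sub_eq_neg_add] using this

theorem continuous_qc (c : ℝ) : Continuous (qc c) := by
  unfold qc
  refine continuous_const.div (by fun_prop) fun t => ?_
  have := Real.pi_pos
  positivity

theorem tendsto_qc_of_sq {c : ℝ} (hc : 0 < c) {l : Filter ℝ}
    (hl : Tendsto (fun t : ℝ => t ^ 2) l atTop) : Tendsto (qc c) l (nhds 0) := by
  unfold qc
  refine Tendsto.div_atTop tendsto_const_nhds (Tendsto.const_mul_atTop Real.pi_pos ?_)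
  exact tendsto_atTop_add_const_right _ _ (hl.const_mul_atTop (by positivity))

theorem stmt17 (p : ℝ → ℝ)
    (hpb : ∃ C, ∀ t, |p t| ≤ C) (hpu : UniformContinuous p)
    -- Hypothesis: x' = −x² + p(t) has exactly two hyperbolic solutions ã and r̃, r̃ < ã
    (ta tr : ℝ → ℝ)
    (hta : IsAttrHyp (fun _ => 0) p ta) (htr : IsRepHyp (fun _ => 0) p tr)
    (htrta : ∀ t, tr t < ta t)
    (honly : ∀ b : ℝ → ℝ, IsHyp (fun _ => 0) p b → b = ta ∨ b = tr)
    (c : ℝ) (hc : 0 < c)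
    (F : MaxSolFamily (quadF (fun _ => 0) (fun t => p t - qc c t)))
    (ac rc : ℝ → ℝ)
    -- a_c solves the equation on R⁻_c and is characterized by boundedness in the past
    (hacsol : ∀ t ∈ Rminus F, HasDerivAt ac (quadF (fun _ => 0) (fun τ => p τ - qc c τ) t (ac t)) t)
    (hacchar : ∀ s ∈ Rminus F, ∀ x₀ : ℝ, BddAtBot F s x₀ ↔ x₀ ≤ ac s)
    -- r_c solves the equation on R⁺_c and is characterized by boundedness in the future
    (hrcsol : ∀ t ∈ Rplus F, HasDerivAt rc (quadF (fun _ => 0) (fun τ => p τ - qc c τ) t (rc t)) t)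
    (hrcchar : ∀ s ∈ Rplus F, ∀ x₀ : ℝ, BddAtTop F s x₀ ↔ rc s ≤ x₀) :
    -- lim_{t→−∞} |ã(t) − a_c(t)| = 0
    Filter.Tendsto (fun t => ta t - ac t) atBot (nhds 0) ∧
    -- lim_{t→∞} |r̃(t) − r_c(t)| = 0
    Filter.Tendsto (fun t => tr t - rc t) atTop (nhds 0) ∧
    -- a_c is locally pullback attracting
    (∃ s₀ ∈ Rminus F, ∃ δ > (0:ℝ),
      (∀ s, s ≤ s₀ → Icc s s₀ ⊆ F.dom s (ac s + δ) ∧ Icc s s₀ ⊆ F.dom s (ac s - δ)) ∧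
      (∀ t, t ≤ s₀ →
        Filter.Tendsto (fun s => F.X t s (ac s + δ)) atBot (nhds (ac t)) ∧
        Filter.Tendsto (fun s => F.X t s (ac s - δ)) atBot (nhds (ac t)))) ∧
    -- r_c is locally pullback repulsive
    (∃ s₀ ∈ Rplus F, ∃ δ > (0:ℝ),
      (∀ s, s₀ ≤ s → Icc s₀ s ⊆ F.dom s (rc s + δ) ∧ Icc s₀ s ⊆ F.dom s (rc s - δ)) ∧
      (∀ t, s₀ ≤ t →
        Filter.Tendsto (fun s => F.X t s (rc s + δ)) atTop (nhds (rc t)) ∧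
        Filter.Tendsto (fun s => F.X t s (rc s - δ)) atTop (nhds (rc t)))) := by
  have hp := hpu.continuous
  have hq := continuous_qc c
  have hbot := asymptotics_past hp hpb hq
    (tendsto_qc_of_sq hc (by
      simpa [Function.comp_def] using
        (tendsto_pow_atTop (α := ℝ) two_ne_zero).comp tendsto_abs_atBot_atTop)) hta htr F hacsol hacchar
  have htop := asymptotics_future hp hpb hq
    (tendsto_qc_of_sq hc (tendsto_pow_atTop two_ne_zero)) hta htr F hrcsol hrcchar
  exact ⟨hbot.1, htop.1, hbot.2, htop.2⟩
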